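/- arXiv:1108.4114 — 4 statements merged into one kernel-verified Lean document; each statement's English description precedes it below -/
import Mathlib

section
/- Suppose condition (⋆) holds. Then for every simple graph g on the vertex set {1,…,n} and every firm i: (a) 2·q_i(g) − ((n−1)/(n+1))·(f(1) − f(0)) > 0; (b) 2·q_i(g) − ((n−1)/(n+1))·(f(−1) − f(0)) > 0; and (c) q_i(g) > 0. -/
open Finset

noncomputable def degree' {n : ℕ} (g : SimpleGraph (Fin n)) (i : Fin n) : ℕ :=
  Nat.card {j | g.Adj i j}

/-- The graph `g` with the edge `ij` deleted. -/
def delE {n : ℕ} (g : SimpleGraph (Fin n)) (i j : Fin n) : SimpleGraph (Fin n) :=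
  g.deleteEdges {s(i, j)}

/-- The graph `g` with the edge `ij` added. -/
def addE {n : ℕ} (g : SimpleGraph (Fin n)) (i j : Fin n) : SimpleGraph (Fin n) :=
  g ⊔ SimpleGraph.fromEdgeSet {s(i, j)}

/-- Cournot equilibrium quantity of firm `i` under collaboration graph `g`. -/
noncomputable def qty {n : ℕ} (α γ₀ : ℝ) (f : ℝ → ℝ) (k : Fin n → ℕ)
    (g : SimpleGraph (Fin n)) (i : Fin n) : ℝ :=
  (α - γ₀ - n * f ((degree' g i : ℝ) - (k i : ℝ))
    + ∑ j ∈ univ.erase i, f ((degree' g j : ℝ) - (k j : ℝ))) / (n + 1)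

/-- Market price under collaboration graph `g`. -/
noncomputable def price {n : ℕ} (α γ₀ : ℝ) (f : ℝ → ℝ) (k : Fin n → ℕ)
    (g : SimpleGraph (Fin n)) : ℝ :=
  α - ∑ i, qty α γ₀ f k g i

/-- Marginal cost of firm `i` under collaboration graph `g`. -/
noncomputable def cost {n : ℕ} (γ₀ : ℝ) (f : ℝ → ℝ) (k : Fin n → ℕ)
    (g : SimpleGraph (Fin n)) (i : Fin n) : ℝ :=
  γ₀ + f ((degree' g i : ℝ) - (k i : ℝ))

/-- Profit of firm `i` under collaboration graph `g`. -/
noncomputable def profit {n : ℕ} (α γ₀ : ℝ) (f : ℝ → ℝ) (k : Fin n → ℕ)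
    (g : SimpleGraph (Fin n)) (i : Fin n) : ℝ :=
  qty α γ₀ f k g i * (price α γ₀ f k g - cost γ₀ f k g i)

/-- A vertex of a simple graph on `n` vertices has degree at most `n - 1`. -/
theorem degree'_add_one_le {n : ℕ} (g : SimpleGraph (Fin n)) (i : Fin n) :
    degree' g i + 1 ≤ n := by
  classical
  have h : degree' g i = g.degree i := by
    rw [← g.card_neighborSet_eq_degree, ← Nat.card_eq_fintype_card]
    rfl
  have hlt := g.degree_lt_card_verts i
  rw [Fintype.card_fin] at hlt
  omega

/-- The numerator of `qty` is bounded below using only the extreme values of `f`. -/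
theorem le_add_one_mul_qty {n : ℕ} (α γ₀ : ℝ) {f : ℝ → ℝ}
    (hconv : ConvexOn ℝ Set.univ f) (hf0 : ∀ x, 0 ≤ f x)
    {k : Fin n → ℕ} (hk : ∀ i, k i ≤ n - 1) (g : SimpleGraph (Fin n)) (i : Fin n) :
    α - γ₀ - n * max (f ((n : ℝ) - 1)) (f (1 - (n : ℝ)))
      ≤ ((n : ℝ) + 1) * qty α γ₀ f k g i := by
  have hdeg : (degree' g i : ℝ) + 1 ≤ n := mod_cast degree'_add_one_le g i
  have hki : (k i : ℝ) + 1 ≤ n := by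
    have h₁ := hk i
    have h₂ := degree'_add_one_le g i
    have h₃ : k i + 1 ≤ n := by omega
    exact_mod_cast h₃
  have hdeg0 : (0 : ℝ) ≤ degree' g i := Nat.cast_nonneg _
  have hki0 : (0 : ℝ) ≤ k i := Nat.cast_nonneg _
  have hmax : f ((degree' g i : ℝ) - k i) ≤ max (f ((n : ℝ) - 1)) (f (1 - (n : ℝ))) := by
    rw [max_comm]
    exact hconv.le_max_of_mem_Icc (Set.mem_univ _) (Set.mem_univ _)
      ⟨by linarith, by linarith⟩
  have hsum : 0 ≤ ∑ j ∈ univ.erase i, f ((degree' g j : ℝ) - (k j : ℝ)) :=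
    sum_nonneg fun j _ => hf0 _
  have hmul := mul_le_mul_of_nonneg_left hmax (Nat.cast_nonneg (α := ℝ) n)
  have hn : (n : ℝ) + 1 ≠ 0 := by positivity
  rw [qty, mul_div_cancel₀ _ hn]
  linarith

/-- under condition (⋆), for every graph and every firm the key
inequalities hold and the Cournot quantity is positive. -/
theorem stmt2 (n : ℕ) (hn : 2 ≤ n) (α γ₀ : ℝ) (f : ℝ → ℝ)
    (hconv : ConvexOn ℝ Set.univ f) (hf0 : ∀ x, 0 ≤ f x) (hfmin : ∀ x, f 0 ≤ f x)
    (k : Fin n → ℕ) (hk : ∀ i, k i ≤ n - 1)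
    (hstar : 0 < α - γ₀ - n * max (f ((n : ℝ) - 1)) (f (1 - (n : ℝ)))
      - (((n : ℝ) - 1) / 2) * max (f 1 - f 0) (f (-1) - f 0)) :
    ∀ (g : SimpleGraph (Fin n)) (i : Fin n),
      0 < 2 * qty α γ₀ f k g i - (((n : ℝ) - 1) / ((n : ℝ) + 1)) * (f 1 - f 0) ∧
      0 < 2 * qty α γ₀ f k g i - (((n : ℝ) - 1) / ((n : ℝ) + 1)) * (f (-1) - f 0) ∧
      0 < qty α γ₀ f k g i := by
  intro g i
  have hq := le_add_one_mul_qty α γ₀ hconv hf0 hk g i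
  have hn1 : (0 : ℝ) ≤ (n : ℝ) - 1 := by
    have : (2 : ℝ) ≤ n := mod_cast hn
    linarith
  have hpos : (0 : ℝ) < (n : ℝ) + 1 := by positivity
  have key : ∀ d, d ≤ max (f 1 - f 0) (f (-1) - f 0) →
      0 < 2 * qty α γ₀ f k g i - (((n : ℝ) - 1) / ((n : ℝ) + 1)) * d := by
    intro d hd
    have hmul := mul_le_mul_of_nonneg_left hd hn1
    rw [sub_pos, div_mul_eq_mul_div, div_lt_iff₀ hpos]
    linarith
  refine ⟨key _ (le_max_left _ _), key _ (le_max_right _ _), ?_⟩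
  have h0 := key 0 (le_max_of_le_left (sub_nonneg.2 (hfmin 1)))
  linarith
end

section
/- Let g be a simple graph on {1,…,n} with η_i(g) = k_i for every firm i, and let ij be an edge of g. Then Y_i(g − ij) − Y_i(g) = −Δ⁻f(0)·((n−1)/(n+1))·(2·q_i(g) − ((n−1)/(n+1))·Δ⁻f(0)). -/
open Finset

theorem qty_eq_sum {n : ℕ} (α γ₀ : ℝ) (f : ℝ → ℝ) (k : Fin n → ℕ)
    (g : SimpleGraph (Fin n)) (i : Fin n) :
    qty α γ₀ f k g i = (α - γ₀ + ∑ j, f ((degree' g j : ℝ) - (k j : ℝ))) / (n + 1)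
      - f ((degree' g i : ℝ) - (k i : ℝ)) := by
  have hn : (n : ℝ) + 1 ≠ 0 := by positivity
  rw [qty, ← Finset.add_sum_erase univ _ (mem_univ i)]
  field_simp
  ring

/-- In equilibrium each firm's markup equals its quantity. -/
theorem price_sub_cost {n : ℕ} (α γ₀ : ℝ) (f : ℝ → ℝ) (k : Fin n → ℕ)
    (g : SimpleGraph (Fin n)) (i : Fin n) :
    price α γ₀ f k g - cost γ₀ f k g i = qty α γ₀ f k g i := by
  have hn : (n : ℝ) + 1 ≠ 0 := by positivity
  simp only [price, cost, qty_eq_sum, sum_sub_distrib, sum_const, card_univ, Fintype.card_fin,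
    nsmul_eq_mul]
  field_simp
  ring

theorem profit_eq_sq {n : ℕ} (α γ₀ : ℝ) (f : ℝ → ℝ) (k : Fin n → ℕ)
    (g : SimpleGraph (Fin n)) (i : Fin n) :
    profit α γ₀ f k g i = qty α γ₀ f k g i ^ 2 := by
  rw [profit, price_sub_cost, sq]

theorem delE_comm {n : ℕ} (g : SimpleGraph (Fin n)) (i j : Fin n) :
    delE g i j = delE g j i := by
  rw [delE, delE, Sym2.eq_swap]

theorem degree'_delE_left {n : ℕ} {g : SimpleGraph (Fin n)} {i j : Fin n} (hij : g.Adj i j) :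
    degree' (delE g i j) i + 1 = degree' g i := by
  have h : {l | (delE g i j).Adj i l} = {l | g.Adj i l} \ {j} := by
    ext l
    simp [delE, SimpleGraph.deleteEdges_adj, hij.ne]
  simp only [degree', h, Nat.card_coe_set_eq]
  exact Set.ncard_sdiff_singleton_add_one hij

theorem degree'_delE_of_ne {n : ℕ} (g : SimpleGraph (Fin n)) {i j l : Fin n}
    (hi : l ≠ i) (hj : l ≠ j) : degree' (delE g i j) l = degree' g l := by
  simp [degree', delE, SimpleGraph.deleteEdges_adj, hi, hj]

theorem sum_delE {n : ℕ} (f : ℝ → ℝ) {k : Fin n → ℕ} {g : SimpleGraph (Fin n)}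
    (hdeg : ∀ l, degree' g l = k l) {i j : Fin n} (hij : g.Adj i j) :
    ∑ l, f ((degree' (delE g i j) l : ℝ) - (k l : ℝ))
      = ∑ l, f ((degree' g l : ℝ) - (k l : ℝ)) + 2 * (f (-1) - f 0) := by
  rw [← sub_eq_iff_eq_add', ← sum_sub_distrib, ← sum_subset (subset_univ {i, j}),
    sum_pair hij.ne]
  · have hi := degree'_delE_left hij
    have hj := degree'_delE_left hij.symm
    rw [delE_comm] at hj
    simp only [← hdeg, ← hi, ← hj, Nat.cast_add, Nat.cast_one, sub_self, sub_add_cancel_left]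
    ring
  · intro l _ hl
    simp only [mem_insert, mem_singleton, not_or] at hl
    rw [degree'_delE_of_ne g hl.1 hl.2, sub_self]

theorem qty_delE {n : ℕ} (α γ₀ : ℝ) (f : ℝ → ℝ) {k : Fin n → ℕ} {g : SimpleGraph (Fin n)}
    (hdeg : ∀ l, degree' g l = k l) {i j : Fin n} (hij : g.Adj i j) :
    qty α γ₀ f k (delE g i j) i
      = qty α γ₀ f k g i - ((n : ℝ) - 1) / ((n : ℝ) + 1) * (f (-1) - f 0) := by
  have hn : (n : ℝ) + 1 ≠ 0 := by positivity
  have hi : (degree' (delE g i j) i : ℝ) - k i = -1 := by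
    rw [← hdeg, ← degree'_delE_left hij]
    push_cast
    ring
  rw [qty_eq_sum, qty_eq_sum, sum_delE f hdeg hij, hi, hdeg i, sub_self]
  field_simp
  ring

/-- profit change from deleting an edge `ij`. -/
theorem stmt5 (n : ℕ) (hn : 2 ≤ n) (α γ₀ : ℝ) (f : ℝ → ℝ)
    (hconv : ConvexOn ℝ Set.univ f) (hf0 : ∀ x, 0 ≤ f x) (hfmin : ∀ x, f 0 ≤ f x)
    (k : Fin n → ℕ) (hk : ∀ i, k i ≤ n - 1)
    (g : SimpleGraph (Fin n)) (hdeg : ∀ i, degree' g i = k i)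
    (i j : Fin n) (hij : g.Adj i j) :
    profit α γ₀ f k (delE g i j) i - profit α γ₀ f k g i
      = -(f (-1) - f 0) * (((n : ℝ) - 1) / ((n : ℝ) + 1))
        * (2 * qty α γ₀ f k g i - (((n : ℝ) - 1) / ((n : ℝ) + 1)) * (f (-1) - f 0)) := by
  rw [profit_eq_sq, profit_eq_sq, qty_delE α γ₀ f hdeg hij]
  ring
end

section
/- Suppose condition (⋆⋆) holds. Then for every simple graph g on the vertex set {1,…,n}, every firm i, and every market node l ∈ V: (a) 2·d_li(g) − ((n−1)/(n+1))·(f(1) − f(0)) > 0; (b) 2·d_li(g) − ((n−1)/(n+1))·(f(−1) − f(0)) > 0; and (c) d_li(g) > 0. -/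
open Finset

/-- Cournot equilibrium quantity shipped by firm `i` to market node `l`
under collaboration graph `g`. -/
noncomputable def dq {n : ℕ} {V : Type*} [Fintype V] (αl : V → ℝ) (γ₀ : ℝ)
    (s : V → Fin n → ℝ) (f : ℝ → ℝ) (k : Fin n → ℕ)
    (g : SimpleGraph (Fin n)) (l : V) (i : Fin n) : ℝ :=
  (αl l - γ₀ - n * (s l i + f ((degree' g i : ℝ) - (k i : ℝ)))
    + ∑ j ∈ univ.erase i, (s l j + f ((degree' g j : ℝ) - (k j : ℝ)))) / (n + 1)

/-- Price at market node `l` under collaboration graph `g`. -/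
noncomputable def priceAt {n : ℕ} {V : Type*} [Fintype V] (αl : V → ℝ) (γ₀ : ℝ)
    (s : V → Fin n → ℝ) (f : ℝ → ℝ) (k : Fin n → ℕ)
    (g : SimpleGraph (Fin n)) (l : V) : ℝ :=
  αl l - ∑ i, dq αl γ₀ s f k g l i

/-- Profit of firm `i` at market node `l` under collaboration graph `g`. -/
noncomputable def profitAt {n : ℕ} {V : Type*} [Fintype V] (αl : V → ℝ) (γ₀ : ℝ)
    (s : V → Fin n → ℝ) (f : ℝ → ℝ) (k : Fin n → ℕ)
    (g : SimpleGraph (Fin n)) (l : V) (i : Fin n) : ℝ :=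
  dq αl γ₀ s f k g l i * (priceAt αl γ₀ s f k g l - cost γ₀ f k g i - s l i)

/-- Total profit of firm `i` across all spatial markets under collaboration graph `g`. -/
noncomputable def totProfit {n : ℕ} {V : Type*} [Fintype V] (αl : V → ℝ) (γ₀ : ℝ)
    (s : V → Fin n → ℝ) (f : ℝ → ℝ) (k : Fin n → ℕ)
    (g : SimpleGraph (Fin n)) (i : Fin n) : ℝ :=
  ∑ l, profitAt αl γ₀ s f k g l i

/-- A vertex of a simple graph on `n` vertices has fewer than `n` neighbours. -/
theorem degree'_lt {n : ℕ} (g : SimpleGraph (Fin n)) (i : Fin n) : degree' g i < n := by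
  have h : {j | g.Adj i j}.ncard < (Set.univ : Set (Fin n)).ncard :=
    Set.ncard_lt_ncard (Set.ssubset_univ_iff.mpr fun h =>
      g.irrefl (h ▸ Set.mem_univ i : i ∈ {j | g.Adj i j}))
  rwa [Set.ncard_univ, Nat.card_fin] at h

/-- A convex cost at a degree discrepancy is bounded by its value at an extreme discrepancy. -/
theorem ConvexOn.degree'_sub_le_max {n : ℕ} {f : ℝ → ℝ} (hconv : ConvexOn ℝ Set.univ f)
    (g : SimpleGraph (Fin n)) (i : Fin n) {m : ℕ} (hm : m ≤ n - 1) :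
    f ((degree' g i : ℝ) - m) ≤ max (f ((n : ℝ) - 1)) (f (1 - (n : ℝ))) := by
  have hlt := degree'_lt g i
  have hdeg : (degree' g i : ℝ) + 1 ≤ n := by exact_mod_cast hlt
  have hm' : (m : ℝ) + 1 ≤ n := by exact_mod_cast (by omega : m + 1 ≤ n)
  have hdeg0 : (0 : ℝ) ≤ degree' g i := Nat.cast_nonneg _
  have hm0 : (0 : ℝ) ≤ m := Nat.cast_nonneg _
  rw [max_comm]
  exact hconv.le_max_of_mem_Icc (Set.mem_univ _) (Set.mem_univ _)
    ⟨by linarith, by linarith⟩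

/-- under condition (⋆⋆), for every graph, firm, and market node
the key inequalities hold and the equilibrium shipment is positive. -/
theorem stmt11 (n : ℕ) (hn : 2 ≤ n) (V : Type*) [Fintype V] (αl : V → ℝ) (γ₀ : ℝ)
    (s : V → Fin n → ℝ) (hs : ∀ l i, 0 ≤ s l i) (f : ℝ → ℝ)
    (hconv : ConvexOn ℝ Set.univ f) (hf0 : ∀ x, 0 ≤ f x) (hfmin : ∀ x, f 0 ≤ f x)
    (k : Fin n → ℕ) (hk : ∀ i, k i ≤ n - 1)
    (M : ℝ) (hM : IsGreatest (Set.range fun p : V × Fin n => s p.1 p.2) M)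
    (hstar : ∀ l : V, 0 < αl l - γ₀ - n * (M + max (f ((n : ℝ) - 1)) (f (1 - (n : ℝ))))
      - (((n : ℝ) - 1) / 2) * max (f 1 - f 0) (f (-1) - f 0)) :
    ∀ (g : SimpleGraph (Fin n)) (i : Fin n) (l : V),
      0 < 2 * dq αl γ₀ s f k g l i - (((n : ℝ) - 1) / ((n : ℝ) + 1)) * (f 1 - f 0) ∧
      0 < 2 * dq αl γ₀ s f k g l i - (((n : ℝ) - 1) / ((n : ℝ) + 1)) * (f (-1) - f 0) ∧
      0 < dq αl γ₀ s f k g l i := by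
  intro g i l
  have hsi : s l i ≤ M := hM.2 ⟨(l, i), rfl⟩
  have hfi := hconv.degree'_sub_le_max g i (hk i)
  have hsum : 0 ≤ ∑ j ∈ univ.erase i, (s l j + f ((degree' g j : ℝ) - (k j : ℝ))) :=
    sum_nonneg fun j _ => add_nonneg (hs l j) (hf0 _)
  have hn1 : (0 : ℝ) ≤ (n : ℝ) - 1 := by
    have : (2 : ℝ) ≤ n := by exact_mod_cast hn
    linarith
  have hpos : (0 : ℝ) < (n : ℝ) + 1 := by linarith
  have hown := mul_le_mul_of_nonneg_left (add_le_add hsi hfi) (Nat.cast_nonneg (α := ℝ) n)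
  have hdq : ((n : ℝ) - 1) / 2 * max (f 1 - f 0) (f (-1) - f 0)
      < dq αl γ₀ s f k g l i * (n + 1) := by
    rw [dq, div_mul_cancel₀ _ hpos.ne']
    linarith [hstar l]
  have key : ∀ y ≤ max (f 1 - f 0) (f (-1) - f 0),
      0 < 2 * dq αl γ₀ s f k g l i - (((n : ℝ) - 1) / ((n : ℝ) + 1)) * y := by
    intro y hy
    have hy' := mul_le_mul_of_nonneg_left hy hn1
    rw [sub_pos, div_mul_eq_mul_div, div_lt_iff₀ hpos]
    linarith
  refine ⟨key _ (le_max_left _ _), key _ (le_max_right _ _), ?_⟩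
  have h0 := key 0 (le_max_of_le_left (sub_nonneg.mpr (hfmin 1)))
  linarith
end

section
/- Let g be a simple graph on {1,…,n} with η_i(g) = k_i for every firm i, and let ij be a pair of distinct vertices that is not an edge of g. Then for every market node l ∈ V, y_li(g + ij) − y_li(g) = −Δ⁺f(0)·((n−1)/(n+1))·(2·d_li(g) − ((n−1)/(n+1))·Δ⁺f(0)). -/
open Finset

/-- A Cournot firm's equilibrium margin at a node equals the quantity it ships there. -/
lemma priceAt_sub_cost_sub {n : ℕ} {V : Type*} [Fintype V] (αl : V → ℝ) (γ₀ : ℝ)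
    (s : V → Fin n → ℝ) (f : ℝ → ℝ) (k : Fin n → ℕ)
    (g : SimpleGraph (Fin n)) (l : V) (i : Fin n) :
    priceAt αl γ₀ s f k g l - cost γ₀ f k g i - s l i = dq αl γ₀ s f k g l i := by
  have hn : (n : ℝ) + 1 ≠ 0 := by positivity
  simp only [priceAt, cost, dq, sum_erase_eq_sub (mem_univ _), ← sum_div, sum_add_distrib,
    sum_sub_distrib, ← mul_sum, sum_const, card_univ, Fintype.card_fin, nsmul_eq_mul]
  field_simp
  ring

lemma profitAt_eq_sq {n : ℕ} {V : Type*} [Fintype V] (αl : V → ℝ) (γ₀ : ℝ)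
    (s : V → Fin n → ℝ) (f : ℝ → ℝ) (k : Fin n → ℕ)
    (g : SimpleGraph (Fin n)) (l : V) (i : Fin n) :
    profitAt αl γ₀ s f k g l i = dq αl γ₀ s f k g l i ^ 2 := by
  rw [profitAt, priceAt_sub_cost_sub, sq]

lemma addE_adj {n : ℕ} (g : SimpleGraph (Fin n)) {i j : Fin n} (hne : i ≠ j) (a b : Fin n) :
    (addE g i j).Adj a b ↔ g.Adj a b ∨ (a = i ∧ b = j) ∨ (a = j ∧ b = i) := by
  simp only [addE, SimpleGraph.sup_adj, SimpleGraph.fromEdgeSet_adj, Set.mem_singleton_iff,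
    Sym2.eq_iff]
  grind

lemma addE_comm {n : ℕ} (g : SimpleGraph (Fin n)) (i j : Fin n) : addE g i j = addE g j i := by
  rw [addE, addE, Sym2.eq_swap]

lemma degree'_addE_left {n : ℕ} (g : SimpleGraph (Fin n)) {i j : Fin n} (hne : i ≠ j)
    (hij : ¬ g.Adj i j) : degree' (addE g i j) i = degree' g i + 1 := by
  have h : {b | (addE g i j).Adj i b} = insert j {b | g.Adj i b} := by
    ext b
    simp only [Set.mem_ofPred_eq, Set.mem_insert_iff, addE_adj g hne]
    grind
  simp only [degree', Nat.card_coe_set_eq, h]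
  exact Set.ncard_insert_of_notMem hij (Set.toFinite _)

lemma degree'_addE_right {n : ℕ} (g : SimpleGraph (Fin n)) {i j : Fin n} (hne : i ≠ j)
    (hij : ¬ g.Adj i j) : degree' (addE g i j) j = degree' g j + 1 := by
  rw [addE_comm, degree'_addE_left g hne.symm fun h => hij h.symm]

lemma degree'_addE_of_ne {n : ℕ} (g : SimpleGraph (Fin n)) {i j a : Fin n} (hne : i ≠ j)
    (hai : a ≠ i) (haj : a ≠ j) : degree' (addE g i j) a = degree' g a := by
  simp [degree', addE_adj g hne, hai, haj]

lemma dq_addE {n : ℕ} {V : Type*} [Fintype V] (αl : V → ℝ) (γ₀ : ℝ)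
    (s : V → Fin n → ℝ) (f : ℝ → ℝ) (k : Fin n → ℕ)
    (g : SimpleGraph (Fin n)) (hdeg : ∀ i, degree' g i = k i)
    {i j : Fin n} (hne : i ≠ j) (hij : ¬ g.Adj i j) (l : V) :
    dq αl γ₀ s f k (addE g i j) l i
      = dq αl γ₀ s f k g l i - ((n : ℝ) - 1) / ((n : ℝ) + 1) * (f 1 - f 0) := by
  have hj : j ∈ univ.erase i := by simp [hne.symm]
  have hrest : ∑ a ∈ (univ.erase i).erase j,
        (s l a + f ((degree' (addE g i j) a : ℝ) - (k a : ℝ)))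
      = ∑ a ∈ (univ.erase i).erase j, (s l a + f ((degree' g a : ℝ) - (k a : ℝ))) := by
    refine sum_congr rfl fun a ha => ?_
    simp only [mem_erase, mem_univ, and_true] at ha
    rw [degree'_addE_of_ne g hne ha.2 ha.1]
  simp only [dq]
  rw [← add_sum_erase _ _ hj, ← add_sum_erase _ _ hj, hrest,
    degree'_addE_left g hne hij, degree'_addE_right g hne hij, hdeg i, hdeg j]
  simp only [Nat.cast_add, Nat.cast_one, add_sub_cancel_left, sub_self]
  ring

/-- nodewise profit change from adding an edge `ij`. -/
theorem stmt15 (n : ℕ) (hn : 2 ≤ n) (V : Type*) [Fintype V] (αl : V → ℝ) (γ₀ : ℝ)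
    (s : V → Fin n → ℝ) (hs : ∀ l i, 0 ≤ s l i) (f : ℝ → ℝ)
    (hconv : ConvexOn ℝ Set.univ f) (hf0 : ∀ x, 0 ≤ f x) (hfmin : ∀ x, f 0 ≤ f x)
    (k : Fin n → ℕ) (hk : ∀ i, k i ≤ n - 1)
    (g : SimpleGraph (Fin n)) (hdeg : ∀ i, degree' g i = k i)
    (i j : Fin n) (hne : i ≠ j) (hij : ¬ g.Adj i j) :
    ∀ l : V,
      profitAt αl γ₀ s f k (addE g i j) l i - profitAt αl γ₀ s f k g l i
        = -(f 1 - f 0) * (((n : ℝ) - 1) / ((n : ℝ) + 1))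
          * (2 * dq αl γ₀ s f k g l i - (((n : ℝ) - 1) / ((n : ℝ) + 1)) * (f 1 - f 0)) := by
  intro l
  rw [profitAt_eq_sq, profitAt_eq_sq, dq_addE αl γ₀ s f k g hdeg hne hij]
  ring
end
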